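/- There exists a constant κ₁ > 0 (independent of γ, B, δ and r) such that for every γ > 0, B > 0, δ > 1/2 and r > 0, setting B_N = B·N^{−δ}, one has lim_{N→∞} N^{3/2}·π_{B_N}({(k,i) ∈ 𝕋×{1,2} : Ψ_{B_N}(k,i) > N·r}) = κ₁·γ^{−3/2}·r^{−3/2}, and likewise lim_{N→∞} N^{3/2}·π_{B_N}({(k,i) ∈ 𝕋×{1,2} : Ψ_{B_N}(k,i) < −N·r}) = κ₁·γ^{−3/2}·r^{−3/2}. -/

import Mathlib

open MeasureTheory Filter Topology

/-- `α̂(k) = 4 sin²(πk)`. -/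
noncomputable def alphaHat (k : ℝ) : ℝ := 4 * Real.sin (Real.pi * k) ^ 2

/-- `ω_{i,B}(k) = √(α̂(k) + B²/4) ± B/2` (plus sign for `i = 1`, minus for `i = 2`). -/
noncomputable def omegaF (B : ℝ) (i : ℕ) (k : ℝ) : ℝ :=
  Real.sqrt (alphaHat k + B ^ 2 / 4) + (if i = 1 then B / 2 else -(B / 2))

/-- `θ_{i,B}(k) = √(ω_{i,B}(k)/(ω_{1,B}(k) + ω_{2,B}(k)))`. -/
noncomputable def thetaF (B : ℝ) (i : ℕ) (k : ℝ) : ℝ :=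
  Real.sqrt (omegaF B i k / (omegaF B 1 k + omegaF B 2 k))

/-- `v_B(k) = α̂′(k)/(2√(α̂(k) + B²/4))`. -/
noncomputable def vF (B : ℝ) (k : ℝ) : ℝ :=
  deriv alphaHat k / (2 * Real.sqrt (alphaHat k + B ^ 2 / 4))

/-- The scattering kernel `R(k,k′) = 16 sin²(πk) sin²(πk′)`. -/
noncomputable def Rker (k k' : ℝ) : ℝ :=
  16 * Real.sin (Real.pi * k) ^ 2 * Real.sin (Real.pi * k') ^ 2

/-- `R(k) = ∫_𝕋 R(k,k′) dk′`, with `𝕋` identified with `[-1/2, 1/2)`. -/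
noncomputable def Rone (k : ℝ) : ℝ := ∫ k' in Set.Ico (-(1 / 2) : ℝ) (1 / 2), Rker k k'

/-- `R̄ = ∫_𝕋 R(k) dk`. -/
noncomputable def Rbar : ℝ := ∫ k in Set.Ico (-(1 / 2) : ℝ) (1 / 2), Rone k

/-- `λ_B(k,i) = (γ θ_{i,B}(k)² R(k))⁻¹`. -/
noncomputable def lamF (γ B : ℝ) (i : ℕ) (k : ℝ) : ℝ :=
  (γ * thetaF B i k ^ 2 * Rone k)⁻¹

/-- `Ψ_B(k,i) = v_B(k)·λ_B(k,i)`. -/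
noncomputable def PsiF (γ B : ℝ) (i : ℕ) (k : ℝ) : ℝ := vF B k * lamF γ B i k

/-- `π_B(S)` for a subset `S` of `𝕋 × {1,2}`: the measure with density
`λ_B(k,i)⁻¹/(γ R̄)` with respect to `dk ⊗ counting`. -/
noncomputable def piMeasF (γ B : ℝ) (S : ℝ → ℕ → Prop) : ℝ :=
  ∑ i ∈ ({1, 2} : Finset ℕ),
    ∫ k in {k : ℝ | k ∈ Set.Ico (-(1 / 2) : ℝ) (1 / 2) ∧ S k i},
      (lamF γ B i k)⁻¹ / (γ * Rbar)

theorem integral_sin_pi_sq :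
    ∫ k in Set.Ico (-(1 / 2) : ℝ) (1 / 2), Real.sin (Real.pi * k) ^ 2 = 1 / 2 := by
  rw [integral_Ico_eq_integral_Ioc, ← intervalIntegral.integral_of_le (by norm_num),
    intervalIntegral.integral_comp_mul_left (fun x => Real.sin x ^ 2) Real.pi_ne_zero,
    integral_sin_sq]
  have h1 : Real.pi * -(1 / 2) = -(Real.pi / 2) := by ring
  have h2 : Real.pi * (1 / 2) = Real.pi / 2 := by ring
  rw [h1, h2]
  simp only [Real.cos_neg, Real.cos_pi_div_two, smul_eq_mul]
  field_simp
  ring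

theorem Rone_eq (k : ℝ) : Rone k = 8 * Real.sin (Real.pi * k) ^ 2 := by
  simp only [Rone, Rker]
  rw [integral_const_mul, integral_sin_pi_sq]
  ring

theorem Rbar_eq : Rbar = 4 := by
  simp only [Rbar, Rone_eq]
  rw [integral_const_mul, integral_sin_pi_sq]
  norm_num

theorem deriv_alphaHat (k : ℝ) :
    deriv alphaHat k = 8 * Real.pi * Real.sin (Real.pi * k) * Real.cos (Real.pi * k) := by
  have h : HasDerivAt alphaHat
      (4 * (2 * Real.sin (Real.pi * k) * (Real.cos (Real.pi * k) * Real.pi))) k := by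
    unfold alphaHat
    simpa using ((((hasDerivAt_id' k).const_mul Real.pi).sin.fun_pow 2).const_mul 4)
  rw [h.deriv]
  ring

theorem alphaHat_nonneg (k : ℝ) : 0 ≤ alphaHat k := by
  unfold alphaHat
  positivity

theorem omegaF_add (B k : ℝ) :
    omegaF B 1 k + omegaF B 2 k = 2 * Real.sqrt (alphaHat k + B ^ 2 / 4) := by
  simp [omegaF]
  ring

theorem sqrt_sub_le_omegaF {B : ℝ} (hB : 0 ≤ B) (i : ℕ) (k : ℝ) :
    Real.sqrt (alphaHat k + B ^ 2 / 4) - B / 2 ≤ omegaF B i k := by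
  unfold omegaF
  split_ifs <;> linarith

theorem half_le_sqrt (B k : ℝ) : B / 2 ≤ Real.sqrt (alphaHat k + B ^ 2 / 4) :=
  Real.le_sqrt_of_sq_le (by linarith [alphaHat_nonneg k])

theorem omegaF_nonneg {B : ℝ} (hB : 0 ≤ B) (i : ℕ) (k : ℝ) : 0 ≤ omegaF B i k := by
  linarith [sqrt_sub_le_omegaF hB i k, half_le_sqrt B k]

theorem omegaF_le {B : ℝ} (hB : 0 ≤ B) (i : ℕ) (k : ℝ) :
    omegaF B i k ≤ 2 * Real.sqrt (alphaHat k + B ^ 2 / 4) := by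
  have := half_le_sqrt B k
  unfold omegaF
  split_ifs <;> linarith

theorem omegaF_pos {B : ℝ} (hB : 0 ≤ B) (i : ℕ) {k : ℝ} (hk : Real.sin (Real.pi * k) ≠ 0) :
    0 < omegaF B i k := by
  refine lt_of_lt_of_le (sub_pos.2 ?_) (sqrt_sub_le_omegaF hB i k)
  apply Real.lt_sqrt_of_sq_lt
  have : 0 < alphaHat k := by unfold alphaHat; positivity
  linarith

theorem thetaF_sq {B : ℝ} (hB : 0 ≤ B) (i : ℕ) (k : ℝ) :
    thetaF B i k ^ 2 = omegaF B i k / (2 * Real.sqrt (alphaHat k + B ^ 2 / 4)) := by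
  rw [thetaF, omegaF_add, Real.sq_sqrt]
  exact div_nonneg (omegaF_nonneg hB i k) (by positivity)

theorem thetaF_sq_le_one {B : ℝ} (hB : 0 ≤ B) (i : ℕ) (k : ℝ) : thetaF B i k ^ 2 ≤ 1 := by
  rw [thetaF_sq hB]
  exact div_le_one_of_le₀ (omegaF_le hB i k) (by positivity)

theorem inv_lamF_div {γ : ℝ} (hγ : 0 < γ) (B : ℝ) (i : ℕ) (k : ℝ) :
    (lamF γ B i k)⁻¹ / (γ * Rbar) = 2 * thetaF B i k ^ 2 * Real.sin (Real.pi * k) ^ 2 := by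
  rw [lamF, inv_inv, Rbar_eq, Rone_eq]
  field_simp
  ring

theorem PsiF_eq (γ : ℝ) {B : ℝ} (hB : 0 ≤ B) (i : ℕ) (k : ℝ) :
    PsiF γ B i k =
      Real.pi * Real.cos (Real.pi * k) / (γ * omegaF B i k * Real.sin (Real.pi * k)) := by
  rw [PsiF, vF, lamF, deriv_alphaHat, Rone_eq, thetaF_sq hB]
  rcases eq_or_ne (Real.sin (Real.pi * k)) 0 with hs | hs
  · simp [hs]
  · have h1 := (omegaF_pos hB i hs).ne'
    have h2 : Real.sqrt (alphaHat k + B ^ 2 / 4) ≠ 0 := by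
      have := omegaF_le hB i k
      have := omegaF_pos hB i hs
      intro h
      linarith
    generalize Real.sqrt (alphaHat k + B ^ 2 / 4) = D at h2 ⊢
    field_simp

theorem measurable_omegaF (B : ℝ) (i : ℕ) : Measurable (omegaF B i) := by
  unfold omegaF alphaHat
  fun_prop

theorem measurable_thetaF (B : ℝ) (i : ℕ) : Measurable (thetaF B i) := by
  have h := measurable_omegaF B
  unfold thetaF
  fun_prop

theorem measurable_PsiF (γ : ℝ) {B : ℝ} (hB : 0 ≤ B) (i : ℕ) : Measurable (PsiF γ B i) := by
  have h := measurable_omegaF B i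
  rw [show PsiF γ B i = _ from funext (PsiF_eq γ hB i)]
  fun_prop

theorem PsiF_neg (γ : ℝ) {B : ℝ} (hB : 0 ≤ B) (i : ℕ) (k : ℝ) :
    PsiF γ B i (-k) = -PsiF γ B i k := by
  simp only [PsiF_eq γ hB, omegaF, alphaHat, mul_neg, Real.sin_neg, Real.cos_neg, even_two,
    Even.neg_pow, div_neg]

theorem thetaF_neg (B : ℝ) (i : ℕ) (k : ℝ) : thetaF B i (-k) = thetaF B i k := by
  simp [thetaF, omegaF, alphaHat]

/-- The rescaled density of `π_B` on the super-level set of `Ψ_B`, in the variable `u = k / (σ h)`,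
where `h = N^(-1/2)` and `B = h β`. -/
noncomputable def rescaledDensity (γ r σ : ℝ) (i : ℕ) (h β : ℝ) : ℝ → ℝ :=
  {u : ℝ | σ * h * u ∈ Set.Ico (-(1 / 2) : ℝ) (1 / 2) ∧ r < h ^ 2 * PsiF γ (h * β) i (h * u)}.indicator
    fun u => 2 * thetaF (h * β) i (h * u) ^ 2 * (Real.sin (Real.pi * (h * u)) / h) ^ 2

theorem measurable_rescaledDensity (γ r σ : ℝ) (i : ℕ) {h β : ℝ} (hh : 0 < h) (hβ : 0 ≤ β) :
    Measurable (rescaledDensity γ r σ i h β) := by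
  have h1 := measurable_PsiF γ (mul_nonneg hh.le hβ) i
  have h2 := measurable_thetaF (h * β) i
  have h3 : Measurable fun u => h ^ 2 * PsiF γ (h * β) i (h * u) := by fun_prop
  have h4 : Measurable fun u => σ * h * u := by fun_prop
  exact Measurable.indicator (by fun_prop)
    ((h4 measurableSet_Ico).inter (measurableSet_lt measurable_const h3))

theorem setIntegral_eq_rescaledDensity {γ : ℝ} (hγ : 0 < γ) (r : ℝ) {σ : ℝ} (hσ : σ = 1 ∨ σ = -1)
    (i : ℕ) {h β : ℝ} (hh : 0 < h) (hβ : 0 ≤ β) :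
    h⁻¹ ^ 3 * ∫ k in {k : ℝ | k ∈ Set.Ico (-(1 / 2) : ℝ) (1 / 2) ∧
        h⁻¹ ^ 2 * r < σ * PsiF γ (h * β) i k}, (lamF γ (h * β) i k)⁻¹ / (γ * Rbar) =
      ∫ u, rescaledDensity γ r σ i h β u := by
  have hB := mul_nonneg hh.le hβ
  have hm : MeasurableSet {k : ℝ | k ∈ Set.Ico (-(1 / 2) : ℝ) (1 / 2) ∧
        h⁻¹ ^ 2 * r < σ * PsiF γ (h * β) i k} := by
    exact measurableSet_Ico.inter
      (measurableSet_lt measurable_const ((measurable_PsiF γ hB i).const_mul σ))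
  have hσh : |(σ * h)⁻¹| = h⁻¹ := by
    rcases hσ with rfl | rfl <;> simp [abs_of_pos hh]
  rw [← integral_indicator hm]
  simp only [inv_lamF_div hγ]
  set F : ℝ → ℝ := Set.indicator _ _ with hF
  have := Measure.integral_comp_mul_left F (σ * h)
  rw [hσh, smul_eq_mul] at this
  rw [pow_succ, mul_assoc, ← this, ← integral_const_mul]
  congr 1
  ext u
  have hP : σ * PsiF γ (h * β) i (σ * h * u) = PsiF γ (h * β) i (h * u) := by
    rcases hσ with rfl | rfl <;> simp [PsiF_neg γ hB]
  have hT : thetaF (h * β) i (σ * h * u) = thetaF (h * β) i (h * u) := by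
    rcases hσ with rfl | rfl <;> simp [thetaF_neg]
  have hS : Real.sin (Real.pi * (σ * h * u)) ^ 2 = Real.sin (Real.pi * (h * u)) ^ 2 := by
    rcases hσ with rfl | rfl <;> simp
  have hiff (x : ℝ) : h⁻¹ ^ 2 * r < x ↔ r < h ^ 2 * x := by
    rw [inv_pow, inv_mul_lt_iff₀ (by positivity)]
  simp only [hF, rescaledDensity, Set.indicator_apply, Set.mem_ofPred_eq, hP, hT, hS, hiff]
  split_ifs
  · field_simp
  · simp

theorem two_mul_le_sin_pi_mul {k : ℝ} (h0 : 0 ≤ k) (h1 : k ≤ 1 / 2) :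
    2 * k ≤ Real.sin (Real.pi * k) := by
  have := Real.mul_le_sin (x := Real.pi * k) (by positivity) (by nlinarith [Real.pi_pos])
  calc 2 * k = 2 / Real.pi * (Real.pi * k) := by field_simp
    _ ≤ _ := this

/-- Support of the rescaled density. -/
theorem mem_Ioc_of_lt_PsiF {γ r : ℝ} (hγ : 0 < γ) (hr : 0 < r) {i : ℕ} {h β C u : ℝ} (hh : 0 < h)
    (hβ : 0 ≤ β) (hβC : β ≤ C) (hu : |h * u| ≤ 1 / 2)
    (hlt : r < h ^ 2 * PsiF γ (h * β) i (h * u)) :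
    u ∈ Set.Ioc 0 (1 + C + Real.pi / (r * γ)) := by
  have hB := mul_nonneg hh.le hβ
  obtain ⟨hu1, hu2⟩ := abs_le.1 hu
  have hpi := Real.pi_pos
  have hΨ : 0 < PsiF γ (h * β) i (h * u) := pos_of_mul_pos_right (hr.trans hlt) (by positivity)
  rw [PsiF_eq γ hB] at hΨ hlt
  have hc : 0 ≤ Real.cos (Real.pi * (h * u)) :=
    Real.cos_nonneg_of_mem_Icc ⟨by nlinarith, by nlinarith⟩
  have hω := omegaF_nonneg hB i (h * u)
  have hu0 : 0 < u := by
    by_contra! hneg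
    have hs : Real.sin (Real.pi * (h * u)) ≤ 0 :=
      Real.sin_nonpos_of_nonpos_of_neg_pi_le
        (mul_nonpos_of_nonneg_of_nonpos hpi.le (mul_nonpos_of_nonneg_of_nonpos hh.le hneg))
        (by nlinarith)
    exact absurd hΨ (not_lt.2 (div_nonpos_of_nonneg_of_nonpos (by positivity)
      (mul_nonpos_of_nonneg_of_nonpos (by positivity) hs)))
  refine ⟨hu0, ?_⟩
  by_contra! hM
  have hC : 0 ≤ C := hβ.trans hβC
  have hq : 0 < Real.pi / (r * γ) := by positivity
  have hs := two_mul_le_sin_pi_mul (by positivity) hu2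
  set s := Real.sin (Real.pi * (h * u)) with hsdef
  have hhu : 0 < h * u := by positivity
  have hs0 : 0 < s := by linarith
  have hβs : h * β ≤ s := by nlinarith
  have hωs : s ≤ omegaF (h * β) i (h * u) := by
    refine le_trans ?_ (sqrt_sub_le_omegaF hB i _)
    rw [le_sub_iff_add_le]
    apply Real.le_sqrt_of_sq_le
    rw [alphaHat, ← hsdef]
    nlinarith
  have hden : γ * (2 * (h * u)) * (2 * (h * u)) ≤ γ * omegaF (h * β) i (h * u) * s := by
    gcongr
    linarith
  have h3 : h ^ 2 * (Real.pi * Real.cos (Real.pi * (h * u)) /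
      (γ * omegaF (h * β) i (h * u) * s)) ≤
      h ^ 2 * (Real.pi * 1 / (γ * (2 * (h * u)) * (2 * (h * u)))) := by
    gcongr
    exact Real.cos_le_one _
  have h4 : h ^ 2 * (Real.pi * 1 / (γ * (2 * (h * u)) * (2 * (h * u)))) =
      Real.pi / (4 * γ * u ^ 2) := by
    field_simp
    norm_num
  rw [h4] at h3
  have h5 := hlt.trans_le h3
  rw [lt_div_iff₀ (by positivity)] at h5
  have h6 : Real.pi / (r * γ) < u := by linarith
  rw [div_lt_iff₀ (by positivity)] at h6
  have hrg : 0 < r * γ := by positivity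
  nlinarith [mul_pos hrg hu0, mul_pos (mul_pos hrg hu0) (by linarith : 0 < u - 1)]

theorem norm_rescaledDensity_le {γ r σ : ℝ} (hγ : 0 < γ) (hr : 0 < r) (hσ : σ = 1 ∨ σ = -1)
    {i : ℕ} {h β C : ℝ} (hh : 0 < h) (hβ : 0 ≤ β) (hβC : β ≤ C) (u : ℝ) :
    ‖rescaledDensity γ r σ i h β u‖ ≤
      (Set.Ioc 0 (1 + C + Real.pi / (r * γ))).indicator (fun u => 2 * (Real.pi * u) ^ 2) u := by
  have hB := mul_nonneg hh.le hβ
  rw [rescaledDensity, norm_indicator_eq_indicator_norm]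
  refine Set.indicator_le_indicator_of_subset ?_ (fun _ => by positivity) u |>.trans'
    (Set.indicator_le_indicator ?_)
  · rintro v ⟨⟨hv1, hv2⟩, hv⟩
    refine mem_Ioc_of_lt_PsiF hγ hr hh hβ hβC ?_ hv
    rcases hσ with rfl | rfl <;> rw [abs_le] <;> constructor <;> linarith
  · rw [Real.norm_of_nonneg (by positivity)]
    have h1 := thetaF_sq_le_one hB i (h * u)
    have h2 : (Real.sin (Real.pi * (h * u)) / h) ^ 2 ≤ (Real.pi * u) ^ 2 := by
      rw [div_pow, div_le_iff₀ (by positivity), ← mul_pow]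
      refine sq_le_sq.2 (Real.abs_sin_le_abs.trans_eq ?_)
      ring_nf
    calc _ ≤ 2 * 1 * (Real.pi * u) ^ 2 := by gcongr
      _ = _ := by ring

section Limits

variable {h β : ℕ → ℝ}

theorem tendsto_sin_div (hh : ∀ᶠ n in atTop, 0 < h n) (h0 : Tendsto h atTop (𝓝 0)) (u : ℝ) :
    Tendsto (fun n => Real.sin (Real.pi * (h n * u)) / h n) atTop (𝓝 (Real.pi * u)) := by
  have hd : HasDerivAt (fun x => Real.sin (Real.pi * (x * u))) (Real.pi * u) 0 := by
    simpa using (((hasDerivAt_id (0 : ℝ)).mul_const u).const_mul Real.pi).sin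
  have ht := (hasDerivAt_iff_tendsto_slope_zero.1 hd).comp
    (tendsto_nhdsWithin_iff.2 ⟨h0, hh.mono fun n hn => hn.ne'⟩)
  refine ht.congr fun n => ?_
  simp [div_eq_inv_mul]

theorem sqrt_alphaHat_div {h : ℝ} (hh : 0 < h) (β u : ℝ) :
    Real.sqrt (alphaHat (h * u) + (h * β) ^ 2 / 4) / h =
      Real.sqrt (4 * (Real.sin (Real.pi * (h * u)) / h) ^ 2 + β ^ 2 / 4) := by
  rw [alphaHat, eq_comm, ← Real.sqrt_sq hh.le, ← Real.sqrt_div' _ (by positivity),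
    Real.sqrt_sq hh.le]
  congr 1
  field_simp

theorem tendsto_sqrt_alphaHat_div (hh : ∀ᶠ n in atTop, 0 < h n) (h0 : Tendsto h atTop (𝓝 0))
    (hβ : Tendsto β atTop (𝓝 0)) {u : ℝ} (hu : 0 < u) :
    Tendsto (fun n => Real.sqrt (alphaHat (h n * u) + (h n * β n) ^ 2 / 4) / h n) atTop
      (𝓝 (2 * (Real.pi * u))) := by
  have ht := ((((tendsto_sin_div hh h0 u).pow 2).const_mul 4).add ((hβ.pow 2).div_const 4)).sqrt
  have hv : Real.sqrt (4 * (Real.pi * u) ^ 2 + 0 ^ 2 / 4) = 2 * (Real.pi * u) := by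
    rw [show 4 * (Real.pi * u) ^ 2 + 0 ^ 2 / 4 = (2 * (Real.pi * u)) ^ 2 by ring]
    exact Real.sqrt_sq (by positivity)
  rw [hv] at ht
  refine ht.congr' ?_
  filter_upwards [hh] with n hn
  rw [sqrt_alphaHat_div hn]

theorem tendsto_omegaF_div (hh : ∀ᶠ n in atTop, 0 < h n) (h0 : Tendsto h atTop (𝓝 0))
    (hβ : Tendsto β atTop (𝓝 0)) (i : ℕ) {u : ℝ} (hu : 0 < u) :
    Tendsto (fun n => omegaF (h n * β n) i (h n * u) / h n) atTop (𝓝 (2 * (Real.pi * u))) := by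
  have ht := (tendsto_sqrt_alphaHat_div hh h0 hβ hu).add
    (hβ.const_mul (if i = 1 then 1 / 2 else -(1 / 2)))
  rw [mul_zero, add_zero] at ht
  refine ht.congr' ?_
  filter_upwards [hh] with n hn
  rw [omegaF]
  split_ifs <;> field_simp

theorem tendsto_thetaF_sq (hh : ∀ᶠ n in atTop, 0 < h n) (h0 : Tendsto h atTop (𝓝 0))
    (hβ : Tendsto β atTop (𝓝 0)) (hβ0 : ∀ n, 0 ≤ β n) (i : ℕ) {u : ℝ} (hu : 0 < u) :
    Tendsto (fun n => thetaF (h n * β n) i (h n * u) ^ 2) atTop (𝓝 (1 / 2)) := by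
  have hpu : 0 < Real.pi * u := by positivity
  have ht := (tendsto_omegaF_div hh h0 hβ i hu).div
    ((tendsto_sqrt_alphaHat_div hh h0 hβ hu).const_mul 2) (by positivity)
  rw [show 2 * (Real.pi * u) / (2 * (2 * (Real.pi * u))) = 1 / 2 by field_simp] at ht
  refine ht.congr' ?_
  filter_upwards [hh] with n hn
  rw [thetaF_sq (mul_nonneg hn.le (hβ0 n)), Pi.div_apply, ← mul_div_assoc,
    div_div_div_cancel_right₀ hn.ne']

theorem tendsto_sq_mul_PsiF (hh : ∀ᶠ n in atTop, 0 < h n) (h0 : Tendsto h atTop (𝓝 0))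
    (hβ : Tendsto β atTop (𝓝 0)) (hβ0 : ∀ n, 0 ≤ β n) {γ : ℝ} (hγ : 0 < γ) (i : ℕ) {u : ℝ}
    (hu : 0 < u) :
    Tendsto (fun n => h n ^ 2 * PsiF γ (h n * β n) i (h n * u)) atTop
      (𝓝 (1 / (2 * Real.pi * γ * u ^ 2))) := by
  have hpu : 0 < Real.pi * u := by positivity
  have hc : Tendsto (fun n => Real.cos (Real.pi * (h n * u))) atTop (𝓝 1) := by
    have : Continuous fun x => Real.cos (Real.pi * (x * u)) := by fun_prop
    simpa [Function.comp_def] using (this.tendsto 0).comp h0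
  have ht := (hc.const_mul Real.pi).div
    (((tendsto_omegaF_div hh h0 hβ i hu).const_mul γ).mul (tendsto_sin_div hh h0 u))
    (by positivity)
  rw [show Real.pi * 1 / (γ * (2 * (Real.pi * u)) * (Real.pi * u)) =
    1 / (2 * Real.pi * γ * u ^ 2) by field_simp] at ht
  refine ht.congr' ?_
  filter_upwards [hh] with n hn
  rw [PsiF_eq γ (mul_nonneg hn.le (hβ0 n)), Pi.div_apply]
  rw [show γ * (omegaF (h n * β n) i (h n * u) / h n) * (Real.sin (Real.pi * (h n * u)) / h n) =
    (γ * omegaF (h n * β n) i (h n * u) * Real.sin (Real.pi * (h n * u))) / h n ^ 2 by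
      field_simp, div_div_eq_mul_div]
  ring

theorem tendsto_rescaledDensity (hh : ∀ᶠ n in atTop, 0 < h n) (h0 : Tendsto h atTop (𝓝 0))
    (hβ : Tendsto β atTop (𝓝 0)) (hβ0 : ∀ n, 0 ≤ β n) {γ r σ : ℝ} (hγ : 0 < γ) (hr : 0 < r)
    (hσ : σ = 1 ∨ σ = -1) (i : ℕ) {K : ℝ} (hK : 0 < K) (hKr : 2 * Real.pi * γ * K ^ 2 * r = 1)
    {u : ℝ} (huK : u ≠ K) :
    Tendsto (fun n => rescaledDensity γ r σ i (h n) (β n) u) atTop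
      (𝓝 ((Set.Ioc 0 K).indicator (fun u => (Real.pi * u) ^ 2) u)) := by
  have hpi := Real.pi_pos
  have hsmall : Tendsto (fun n => σ * h n * u) atTop (𝓝 0) := by
    simpa using (h0.const_mul σ).mul_const u
  have hlim : 0 < 2 * Real.pi * γ * K ^ 2 := by positivity
  have hrK : r = 1 / (2 * Real.pi * γ * K ^ 2) := by
    rw [eq_div_iff hlim.ne']
    linarith
  rcases le_or_gt u 0 with hu | hu
  · rw [Set.indicator_of_notMem fun hm => absurd hm.1 hu.not_gt]
    refine tendsto_const_nhds.congr' ?_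
    filter_upwards [hh] with n hn
    rw [rescaledDensity, Set.indicator_of_notMem]
    rintro ⟨⟨h1, h2⟩, h3⟩
    refine (mem_Ioc_of_lt_PsiF hγ hr hn (hβ0 n) le_rfl ?_ h3).1.not_ge hu
    rcases hσ with rfl | rfl <;> rw [abs_le] <;> constructor <;> linarith
  have hΨ := tendsto_sq_mul_PsiF hh h0 hβ hβ0 hγ i hu
  rcases huK.lt_or_gt with hlt | hgt
  · rw [Set.indicator_of_mem (show u ∈ Set.Ioc 0 K from ⟨hu, hlt.le⟩)]
    have ht := ((tendsto_thetaF_sq hh h0 hβ hβ0 i hu).const_mul 2).mul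
      ((tendsto_sin_div hh h0 u).pow 2)
    rw [show 2 * (1 / 2) * (Real.pi * u) ^ 2 = (Real.pi * u) ^ 2 by ring] at ht
    have hr' : r < 1 / (2 * Real.pi * γ * u ^ 2) := by
      rw [hrK]
      gcongr
    refine ht.congr' ?_
    filter_upwards [hΨ.eventually_const_lt hr',
      hsmall.eventually_const_lt (by norm_num : (-(1 / 2) : ℝ) < 0),
      hsmall.eventually_lt_const (by norm_num : (0 : ℝ) < 1 / 2)] with n h1 h2 h3
    rw [rescaledDensity, Set.indicator_of_mem]
    exact ⟨⟨h2.le, h3⟩, h1⟩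
  · rw [Set.indicator_of_notMem fun hm => absurd hm.2 hgt.not_ge]
    have hr' : 1 / (2 * Real.pi * γ * u ^ 2) < r := by
      rw [hrK]
      gcongr
    refine tendsto_const_nhds.congr' ?_
    filter_upwards [hΨ.eventually_lt_const hr'] with n h1
    rw [rescaledDensity, Set.indicator_of_notMem]
    exact fun hm => hm.2.not_gt h1

theorem tendsto_integral_rescaledDensity (hh : ∀ᶠ n in atTop, 0 < h n)
    (h0 : Tendsto h atTop (𝓝 0)) (hβ : Tendsto β atTop (𝓝 0)) (hβ0 : ∀ n, 0 ≤ β n) {γ r σ : ℝ}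
    (hγ : 0 < γ) (hr : 0 < r) (hσ : σ = 1 ∨ σ = -1) (i : ℕ) {K : ℝ} (hK : 0 < K)
    (hKr : 2 * Real.pi * γ * K ^ 2 * r = 1) :
    Tendsto (fun n => ∫ u, rescaledDensity γ r σ i (h n) (β n) u) atTop
      (𝓝 (Real.pi ^ 2 * K ^ 3 / 3)) := by
  have hint : ∫ u, (Set.Ioc 0 K).indicator (fun u => (Real.pi * u) ^ 2) u =
      Real.pi ^ 2 * K ^ 3 / 3 := by
    rw [integral_indicator measurableSet_Ioc, ← intervalIntegral.integral_of_le hK.le]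
    simp only [mul_pow, intervalIntegral.integral_const_mul, integral_pow]
    norm_num
    ring
  rw [← hint]
  refine tendsto_integral_filter_of_dominated_convergence
    ((Set.Ioc 0 (1 + 1 + Real.pi / (r * γ))).indicator fun u => 2 * (Real.pi * u) ^ 2) ?_ ?_ ?_ ?_
  · filter_upwards [hh] with n hn
    exact (measurable_rescaledDensity γ r σ i hn (hβ0 n)).aestronglyMeasurable
  · filter_upwards [hh, hβ.eventually_le_const one_pos] with n hn h1
    exact .of_forall (norm_rescaledDensity_le hγ hr hσ hn (hβ0 n) h1)
  · rw [integrable_indicator_iff measurableSet_Ioc]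
    exact (Continuous.integrableOn_Icc (by fun_prop)).mono_set Set.Ioc_subset_Icc_self
  · filter_upwards [Measure.ae_ne volume K] with u hu
    exact tendsto_rescaledDensity hh h0 hβ hβ0 hγ hr hσ i hK hKr hu

end Limits

theorem tendsto_piMeasF {γ B δ r σ : ℝ} (hγ : 0 < γ) (hB : 0 < B) (hδ : 1 / 2 < δ) (hr : 0 < r)
    (hσ : σ = 1 ∨ σ = -1) :
    Tendsto (fun N : ℕ => (N : ℝ) ^ ((3 : ℝ) / 2) *
      piMeasF γ (B * (N : ℝ) ^ (-δ))
        (fun k i => (N : ℝ) * r < σ * PsiF γ (B * (N : ℝ) ^ (-δ)) i k)) atTop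
      (𝓝 (2 * Real.pi ^ 2 / 3 * (2 * Real.pi) ^ (-(3 / 2) : ℝ) * γ ^ (-(3 / 2) : ℝ) *
        r ^ (-(3 / 2) : ℝ))) := by
  have hpi := Real.pi_pos
  have hx : 0 < 2 * Real.pi * γ * r := by positivity
  have hh : ∀ᶠ N : ℕ in atTop, 0 < (N : ℝ) ^ (-(1 / 2) : ℝ) := by
    filter_upwards [eventually_gt_atTop 0] with N hN
    positivity
  have h0 : Tendsto (fun N : ℕ => (N : ℝ) ^ (-(1 / 2) : ℝ)) atTop (𝓝 0) :=
    (tendsto_rpow_neg_atTop (by norm_num)).comp tendsto_natCast_atTop_atTop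
  have hβ : Tendsto (fun N : ℕ => B * (N : ℝ) ^ (-(δ - 1 / 2))) atTop (𝓝 0) := by
    simpa using ((tendsto_rpow_neg_atTop (sub_pos.2 hδ)).comp
      tendsto_natCast_atTop_atTop).const_mul B
  have hβ0 (N : ℕ) : 0 ≤ B * (N : ℝ) ^ (-(δ - 1 / 2)) := by positivity
  have hK : 0 < (2 * Real.pi * γ * r) ^ (-(1 / 2) : ℝ) := by positivity
  have hKr : 2 * Real.pi * γ * ((2 * Real.pi * γ * r) ^ (-(1 / 2) : ℝ)) ^ 2 * r = 1 := by
    rw [← Real.rpow_mul_natCast hx.le]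
    norm_num [Real.rpow_neg_one]
    field_simp
  have ht (i : ℕ) := tendsto_integral_rescaledDensity hh h0 hβ hβ0 hγ hr hσ i hK hKr
  have hval : Real.pi ^ 2 * ((2 * Real.pi * γ * r) ^ (-(1 / 2) : ℝ)) ^ 3 / 3 +
      Real.pi ^ 2 * ((2 * Real.pi * γ * r) ^ (-(1 / 2) : ℝ)) ^ 3 / 3 =
      2 * Real.pi ^ 2 / 3 * (2 * Real.pi) ^ (-(3 / 2) : ℝ) * γ ^ (-(3 / 2) : ℝ) *
        r ^ (-(3 / 2) : ℝ) := by
    rw [← Real.rpow_mul_natCast hx.le,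
      show (-(1 / 2) : ℝ) * (3 : ℕ) = -(3 / 2) by norm_num,
      Real.mul_rpow (by positivity) hr.le, Real.mul_rpow (by positivity) hγ.le]
    ring
  rw [← hval]
  refine ((ht 1).add (ht 2)).congr' ?_
  filter_upwards [eventually_gt_atTop 0, hh] with N hN hn
  have hN' : (0 : ℝ) < N := by exact_mod_cast hN
  have e1 : B * (N : ℝ) ^ (-δ) =
      (N : ℝ) ^ (-(1 / 2) : ℝ) * (B * (N : ℝ) ^ (-(δ - 1 / 2))) := by
    rw [mul_left_comm, ← Real.rpow_add hN']
    ring_nf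
  have e2 : (N : ℝ) = ((N : ℝ) ^ (-(1 / 2) : ℝ))⁻¹ ^ 2 := by
    rw [← Real.rpow_neg hN'.le, ← Real.rpow_mul_natCast hN'.le]
    norm_num
  have e3 : (N : ℝ) ^ ((3 : ℝ) / 2) = ((N : ℝ) ^ (-(1 / 2) : ℝ))⁻¹ ^ 3 := by
    rw [← Real.rpow_neg hN'.le, ← Real.rpow_mul_natCast hN'.le]
    norm_num
  have e4 (x : ℝ) : (N : ℝ) * r < x ↔ ((N : ℝ) ^ (-(1 / 2) : ℝ))⁻¹ ^ 2 * r < x := by rw [← e2]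
  rw [← setIntegral_eq_rescaledDensity hγ r hσ 1 hn (hβ0 N),
    ← setIntegral_eq_rescaledDensity hγ r hσ 2 hn (hβ0 N), piMeasF,
    Finset.sum_pair (by norm_num), e3, mul_add]
  simp only [e1, e4]

/-- There is a universal constant `κ₁ > 0` such that for all `γ > 0`, `B > 0`,
`δ > 1/2` and `r > 0`, with `B_N = B·N^(-δ)`,
`N^(3/2)·π_{B_N}({Ψ_{B_N} > N r}) → κ₁·γ^(-3/2)·r^(-3/2)` and
`N^(3/2)·π_{B_N}({Ψ_{B_N} < -N r}) → κ₁·γ^(-3/2)·r^(-3/2)` as `N → ∞`. -/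
theorem stmt_9 :
    ∃ κ₁ : ℝ, 0 < κ₁ ∧
      ∀ γ B δ r : ℝ, 0 < γ → 0 < B → 1 / 2 < δ → 0 < r →
        Tendsto (fun N : ℕ => (N : ℝ) ^ ((3 : ℝ) / 2) *
            piMeasF γ (B * (N : ℝ) ^ (-δ))
              (fun k i => (N : ℝ) * r < PsiF γ (B * (N : ℝ) ^ (-δ)) i k)) atTop
          (𝓝 (κ₁ * γ ^ (-(3 / 2) : ℝ) * r ^ (-(3 / 2) : ℝ))) ∧
        Tendsto (fun N : ℕ => (N : ℝ) ^ ((3 : ℝ) / 2) *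
            piMeasF γ (B * (N : ℝ) ^ (-δ))
              (fun k i => PsiF γ (B * (N : ℝ) ^ (-δ)) i k < -((N : ℝ) * r))) atTop
          (𝓝 (κ₁ * γ ^ (-(3 / 2) : ℝ) * r ^ (-(3 / 2) : ℝ))) := by
  refine ⟨2 * Real.pi ^ 2 / 3 * (2 * Real.pi) ^ (-(3 / 2) : ℝ), by positivity,
    fun γ B δ r hγ hB hδ hr => ⟨?_, ?_⟩⟩
  · simpa only [one_mul] using tendsto_piMeasF hγ hB hδ hr (Or.inl rfl)
  · simpa only [neg_one_mul, lt_neg] using tendsto_piMeasF hγ hB hδ hr (Or.inr rfl)
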